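/- For all Boolean normal monotonic (BNM) schemes 𝕏, 𝕏', 𝕏'' and for all 𝕄, ℕ belonging to the four-element family {ST(𝕏''), SS(𝕏), TT(𝕏'), SS(𝕏) ∩ TT(𝕏')}: 𝕄 ⊆ ℕ if and only if T(𝕄 ∪ ℕ) = ℕ. -/

import Mathlib

namespace ThreeValued

/-- Formulas of the propositional language: countably many variables,
negation, conjunction, disjunction. -/
inductive Fml : Type
  | var : ℕ → Fml
  | neg : Fml → Fml
  | conj : Fml → Fml → Fml
  | disj : Fml → Fml → Fml
deriving DecidableEq

/-- An inference Γ ⇒ φ: a finite set of premises and a conclusion. -/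
structure Infer : Type where
  prem : Finset Fml
  concl : Fml

/-- A set of inferences is closed under transitivity:
whenever there is a nonempty Δ with Δ ⇒ φ ∈ L and Γ ⇒ δ ∈ L for all δ ∈ Δ,
then Γ ⇒ φ ∈ L. -/
def TransClosed (L : Set Infer) : Prop :=
  ∀ (Γ Δ : Finset Fml) (φ : Fml), Δ.Nonempty →
    (⟨Δ, φ⟩ : Infer) ∈ L → (∀ δ ∈ Δ, (⟨Γ, δ⟩ : Infer) ∈ L) → (⟨Γ, φ⟩ : Infer) ∈ L

/-- The transitive closure of a set of inferences: the least superset closed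
under transitivity. -/
def T (L : Set Infer) : Set Infer := ⋂₀ {L' : Set Infer | L ⊆ L' ∧ TransClosed L'}

/-- A set of inferences is open under dual transitivity:
whenever there is a nonempty Δ with Δ ⇒ φ ∉ L and Γ ⇒ δ ∉ L for all δ ∈ Δ,
then Γ ⇒ φ ∉ L. -/
def DualTransClosed (L : Set Infer) : Prop :=
  ∀ (Γ Δ : Finset Fml) (φ : Fml), Δ.Nonempty →
    (⟨Δ, φ⟩ : Infer) ∉ L → (∀ δ ∈ Δ, (⟨Γ, δ⟩ : Infer) ∉ L) → (⟨Γ, φ⟩ : Infer) ∉ L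

/-- The dual transitive closure: the greatest subset open under dual
transitivity. -/
def Td (L : Set Infer) : Set Infer := ⋃₀ {L' : Set Infer | L' ⊆ L ∧ DualTransClosed L'}

/-- The three truth values 0, 1/2, 1. -/
inductive V3 : Type
  | zero | half | one
deriving DecidableEq

/-- A three-valued scheme: a triple of truth functions for ¬, ∧ and ∨. -/
structure Scheme : Type where
  fneg : V3 → V3
  fconj : V3 → V3 → V3
  fdisj : V3 → V3 → V3

/-- Boolean normality: on Boolean inputs the operations agree with the
classical ones. -/
def BooleanNormal (X : Scheme) : Prop :=
  X.fneg .zero = .one ∧ X.fneg .one = .zero ∧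
  X.fconj .one .one = .one ∧ X.fconj .one .zero = .zero ∧
  X.fconj .zero .one = .zero ∧ X.fconj .zero .zero = .zero ∧
  X.fdisj .one .one = .one ∧ X.fdisj .one .zero = .one ∧
  X.fdisj .zero .one = .one ∧ X.fdisj .zero .zero = .zero

/-- The information order: 1/2 is below 0 and below 1. -/
def infLe (a b : V3) : Prop := a = .half ∨ a = b

/-- Monotonicity of a scheme with respect to the information order. -/
def Monotonic (X : Scheme) : Prop :=
  (∀ a b, infLe a b → infLe (X.fneg a) (X.fneg b)) ∧
  (∀ a₁ a₂ b₁ b₂, infLe a₁ b₁ → infLe a₂ b₂ → infLe (X.fconj a₁ a₂) (X.fconj b₁ b₂)) ∧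
  (∀ a₁ a₂ b₁ b₂, infLe a₁ b₁ → infLe a₂ b₂ → infLe (X.fdisj a₁ a₂) (X.fdisj b₁ b₂))

/-- Boolean normal monotonic schemes. -/
def BNM (X : Scheme) : Prop := BooleanNormal X ∧ Monotonic X

/-- Valuations respecting a scheme. -/
def Respects (X : Scheme) (v : Fml → V3) : Prop :=
  (∀ φ, v (.neg φ) = X.fneg (v φ)) ∧
  (∀ φ ψ, v (.conj φ ψ) = X.fconj (v φ) (v ψ)) ∧
  (∀ φ ψ, v (.disj φ ψ) = X.fdisj (v φ) (v ψ))

/-- The strict formula-standard s = {1}. -/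
def sStd : Set V3 := {.one}

/-- The tolerant formula-standard t = {1, 1/2}. -/
def tStd : Set V3 := {.one, .half}

/-- An inference is xy-valid over a scheme X if every valuation respecting X
whose value on each premise is in x gives the conclusion a value in y. -/
def Valid (X : Scheme) (x y : Set V3) (I : Infer) : Prop :=
  ∀ v : Fml → V3, Respects X v → (∀ γ ∈ I.prem, v γ ∈ x) → v I.concl ∈ y

/-- The ss-valid inferences over X. -/
def SS (X : Scheme) : Set Infer := {I | Valid X sStd sStd I}

/-- The tt-valid inferences over X. -/
def TT (X : Scheme) : Set Infer := {I | Valid X tStd tStd I}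

/-- The st-valid inferences over X. -/
def ST (X : Scheme) : Set Infer := {I | Valid X sStd tStd I}

/-- The ts-valid inferences over X. -/
def TS (X : Scheme) : Set Infer := {I | Valid X tStd sStd I}

/-- Classical two-valued valuations. -/
def RespectsCL (v : Fml → Bool) : Prop :=
  (∀ φ, v (.neg φ) = ! v φ) ∧
  (∀ φ ψ, v (.conj φ ψ) = (v φ && v ψ)) ∧
  (∀ φ ψ, v (.disj φ ψ) = (v φ || v ψ))

/-- The classically valid inferences. -/
def CL : Set Infer :=
  {I | ∀ v : Fml → Bool, RespectsCL v → (∀ γ ∈ I.prem, v γ = true) → v I.concl = true}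

/-- Substitution: the homomorphic extension of a map from variables to
formulas. -/
def subst (σ : ℕ → Fml) : Fml → Fml
  | .var n => σ n
  | .neg φ => .neg (subst σ φ)
  | .conj φ ψ => .conj (subst σ φ) (subst σ ψ)
  | .disj φ ψ => .disj (subst σ φ) (subst σ ψ)

/-- Reflexivity. -/
def PropR (L : Set Infer) : Prop := ∀ φ : Fml, (⟨{φ}, φ⟩ : Infer) ∈ L

/-- Monotonicity (weakening). -/
def PropM (L : Set Infer) : Prop :=
  ∀ (Γ Sg : Finset Fml) (φ : Fml), (⟨Γ, φ⟩ : Infer) ∈ L → Γ ⊆ Sg → (⟨Sg, φ⟩ : Infer) ∈ L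

/-- Structurality (closure under substitutions). -/
def PropS (L : Set Infer) : Prop :=
  ∀ (Γ : Finset Fml) (φ : Fml), (⟨Γ, φ⟩ : Infer) ∈ L →
    ∀ σ : ℕ → Fml, (⟨Γ.image (subst σ), subst σ φ⟩ : Infer) ∈ L

/-- The Tarskian closure: the least superset satisfying (R), (M), (T), (S). -/
def Tar (L : Set Infer) : Set Infer :=
  ⋂₀ {L' : Set Infer | L ⊆ L' ∧ PropR L' ∧ PropM L' ∧ TransClosed L' ∧ PropS L'}

/-- L⋆: the inferences whose premise set is an antitheorem of L or whose
conclusion is a theorem of L. -/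
def starL (L : Set Infer) : Set Infer :=
  {I | (∀ ψ : Fml, (⟨I.prem, ψ⟩ : Infer) ∈ L) ∨ (∀ Δ : Finset Fml, (⟨Δ, I.concl⟩ : Infer) ∈ L)}

/-- The propositional variables occurring in a formula. -/
def fvars : Fml → Finset ℕ
  | .var n => {n}
  | .neg φ => fvars φ
  | .conj φ ψ => fvars φ ∪ fvars ψ
  | .disj φ ψ => fvars φ ∪ fvars ψ

theorem subset_T (L : Set Infer) : L ⊆ T L :=
  Set.subset_sInter fun _ h => h.1

theorem TransClosed.T_eq {L : Set Infer} (h : TransClosed L) : T L = L :=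
  Set.Subset.antisymm (fun _ hI => hI L ⟨subset_rfl, h⟩) (subset_T L)

theorem TransClosed.inter {L L' : Set Infer} (h : TransClosed L) (h' : TransClosed L') :
    TransClosed (L ∩ L') := fun Γ Δ φ hne hΔ hΓ =>
  ⟨h Γ Δ φ hne hΔ.1 fun δ hδ => (hΓ δ hδ).1, h' Γ Δ φ hne hΔ.2 fun δ hδ => (hΓ δ hδ).2⟩

theorem transClosed_valid_self (X : Scheme) (x : Set V3) : TransClosed {I | Valid X x x I} :=
  fun _ _ _ _ hΔ hΓ v hv hp => hΔ v hv fun δ hδ => hΓ δ hδ v hv hp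

/-- The valuation respecting `X` that agrees with `v` on variables, except that
the value 1/2 is replaced by 0. -/
def sharpen (X : Scheme) (v : Fml → V3) : Fml → V3
  | .var n => if v (.var n) = .half then .zero else v (.var n)
  | .neg φ => X.fneg (sharpen X v φ)
  | .conj φ ψ => X.fconj (sharpen X v φ) (sharpen X v ψ)
  | .disj φ ψ => X.fdisj (sharpen X v φ) (sharpen X v ψ)

theorem respects_sharpen (X : Scheme) (v : Fml → V3) : Respects X (sharpen X v) :=
  ⟨fun _ => rfl, fun _ _ => rfl, fun _ _ => rfl⟩

theorem sharpen_ne_half {X : Scheme} (hX : BooleanNormal X) (v : Fml → V3) (φ : Fml) :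
    sharpen X v φ ≠ .half := by
  obtain ⟨n0, n1, c11, c10, c01, c00, d11, d10, d01, d00⟩ := hX
  induction φ with
  | var n => simp only [sharpen]; split_ifs with h <;> simp [h]
  | neg φ ih =>
    simp only [sharpen]
    cases h : sharpen X v φ <;> simp_all
  | conj φ ψ ih ih' =>
    simp only [sharpen]
    cases h : sharpen X v φ <;> cases h' : sharpen X v ψ <;> simp_all
  | disj φ ψ ih ih' =>
    simp only [sharpen]
    cases h : sharpen X v φ <;> cases h' : sharpen X v ψ <;> simp_all

theorem infLe_sharpen {X : Scheme} (hX : Monotonic X) {v : Fml → V3} (hv : Respects X v)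
    (φ : Fml) : infLe (v φ) (sharpen X v φ) := by
  induction φ with
  | var n =>
    by_cases h : v (.var n) = .half
    · exact Or.inl h
    · exact Or.inr (by simp [sharpen, h])
  | neg φ ih => rw [hv.1]; exact hX.1 _ _ ih
  | conj φ ψ ih ih' => rw [hv.2.1]; exact hX.2.1 _ _ _ _ ih ih'
  | disj φ ψ ih ih' => rw [hv.2.2]; exact hX.2.2 _ _ _ _ ih ih'

theorem transClosed_ST {X : Scheme} (hX : BNM X) : TransClosed (ST X) := by
  intro Γ Δ φ _ hΔ hΓ v hv hp
  have hw := respects_sharpen X v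
  have strict : ∀ ψ, sharpen X v ψ ∈ tStd → sharpen X v ψ = .one := fun ψ h =>
    Or.resolve_right h (sharpen_ne_half hX.1 v ψ)
  have hpw : ∀ γ ∈ Γ, sharpen X v γ ∈ sStd := by
    intro γ hγ
    have h1 : v γ = .one := hp γ hγ
    rcases infLe_sharpen hX.2 hv γ with h | h
    · simp [h1] at h
    · exact h.symm.trans h1
  have hφ := strict φ (hΔ _ hw fun δ hδ => strict δ (hΓ δ hδ _ hw hpw))
  rcases infLe_sharpen hX.2 hv φ with h | h
  · exact Or.inr h
  · exact Or.inl (h.trans hφ)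

/-- On the four-element family {ST(X''), SS(X), TT(X'), SS(X) ∩ TT(X')},
inclusion is characterized by the transitive closure of the union. -/
theorem stmt16 : ∀ X X' X'' : Scheme, BNM X → BNM X' → BNM X'' →
    ∀ M N : Set Infer,
      M ∈ ({ST X'', SS X, TT X', SS X ∩ TT X'} : Set (Set Infer)) →
      N ∈ ({ST X'', SS X, TT X', SS X ∩ TT X'} : Set (Set Infer)) →
      (M ⊆ N ↔ T (M ∪ N) = N) := by
  intro X X' X'' _ _ hX'' M N _ hN
  have hclosed : TransClosed N := by
    rcases hN with rfl | rfl | rfl | rfl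
    · exact transClosed_ST hX''
    · exact transClosed_valid_self X sStd
    · exact transClosed_valid_self X' tStd
    · exact (transClosed_valid_self X sStd).inter (transClosed_valid_self X' tStd)
  constructor
  · intro h
    rw [Set.union_eq_self_of_subset_left h, hclosed.T_eq]
  · intro h
    exact (Set.subset_union_left.trans (subset_T (M ∪ N))).trans h.subset

end ThreeValued
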